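/- arXiv:2307.15485 — 3 statements merged into one kernel-verified Lean document; each statement's English description precedes it below -/
import Mathlib

section
/- Assume each R i is an equivalence relation and R satisfies the commutativity frame property. Let L = [i_1, …, i_m] be a duplicate-free list of agents with m ≥ 2, and let G be the set of its entries. Then the reflexive-transitive closure of the union relation R_G (where R_G w v iff ∃ i ∈ G, R i w v) coincides with comp(L): for all worlds w, w', ReflTransGen R_G w w' ↔ comp(L) w w'. (Semantic counterpart of Theorem 2, the finitary non-fixpoint characterization of common knowledge: in C-S5_n, □_{i_1}…□_{i_m}φ ↔ C_G φ is a theorem.) -/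
/-- Relational composition along a list of agents. -/
def comp {W I : Type*} (R : I → W → W → Prop) : List I → W → W → Prop
  | [], w, v => w = v
  | i :: l, w, v => ∃ u, R i w u ∧ comp R l u v

/-- The commutativity frame property (correspondent of axiom C). -/
def CommFrame {W I : Type*} (R : I → W → W → Prop) : Prop :=
  ∀ (i j : I) (u v w : W), R j u v → R i v w → ∃ x, R i u x ∧ R j x w

theorem comp_refl {W I : Type*} {R : I → W → W → Prop}
    (hEq : ∀ i, Equivalence (R i)) (l : List I) (w : W) : comp R l w w := by
  induction l with
  | nil => rfl
  | cons i l ih => exact ⟨w, (hEq i).refl w, ih⟩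

/-- Under commutativity, a step of an agent occurring in `l` is absorbed by `comp R l`. -/
theorem comp_of_rel_of_comp {W I : Type*} {R : I → W → W → Prop}
    (hEq : ∀ i, Equivalence (R i)) (hC : CommFrame R) {i : I} {l : List I} (hi : i ∈ l)
    {w u v : W} (hwu : R i w u) (huv : comp R l u v) : comp R l w v := by
  induction l generalizing w u with
  | nil => cases hi
  | cons j l ih =>
    obtain ⟨x, hux, hxv⟩ := huv
    rcases List.mem_cons.1 hi with rfl | hi
    · exact ⟨x, (hEq i).trans hwu hux, hxv⟩
    · obtain ⟨y, hwy, hyx⟩ := hC j i w u x hwu hux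
      exact ⟨y, hwy, ih hi hyx hxv⟩

theorem reflTransGen_of_comp {W I : Type*} {R : I → W → W → Prop} {l L : List I}
    (hl : l ⊆ L) {w v : W} (h : comp R l w v) :
    Relation.ReflTransGen (fun a b => ∃ i ∈ L, R i a b) w v := by
  induction l generalizing w with
  | nil => exact h ▸ .refl
  | cons i l ih =>
    obtain ⟨u, hwu, huv⟩ := h
    exact .head ⟨i, hl List.mem_cons_self, hwu⟩ (ih (List.subset_of_cons_subset hl) huv)

/-- Semantic counterpart of Theorem 2 (finitary non-fixpoint characterization of common
knowledge): the common-knowledge relation of the agents of a duplicate-free list `L`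
(with `|L| ≥ 2`) coincides with the composition along `L`. -/
theorem reflTransGen_iff_comp {W I : Type*} (R : I → W → W → Prop)
    (hEq : ∀ i, Equivalence (R i)) (hC : CommFrame R)
    (L : List I) (hnd : L.Nodup) (hm : 2 ≤ L.length) :
    ∀ w w' : W,
      Relation.ReflTransGen (fun a b => ∃ i ∈ L, R i a b) w w' ↔ comp R L w w' := by
  intro w w'
  refine ⟨fun h => ?_, reflTransGen_of_comp (List.Subset.refl L)⟩
  induction h using Relation.ReflTransGen.head_induction_on with
  | refl => exact comp_refl hEq L w'
  | head h _ ih =>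
    obtain ⟨i, hi, hR⟩ := h
    exact comp_of_rel_of_comp hEq hC hi hR ih
end

section
/- Let b ≥ 1 and let i, j be two distinct agents; assume R i and R j are equivalence relations on W and the b-commutativity frame property holds for the pair (i, j) in both orders. Then the reflexive-transitive closure of the union of R i and R j coincides with comp(alt(i,j,2b)): for all worlds w, w', ReflTransGen (R i ⊔ R j) w w' ↔ comp(alt(i,j,2b)) w w'. (Semantic counterpart of the appendix theorem for C^b-S5_2: (□_i□_j)^b φ ↔ C_{{i,j}} φ is a theorem.) -/
/-- `alt i j k` is the alternating list `[i, j, i, j, …]` of length `k`. -/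
def alt {I : Type*} (i j : I) : ℕ → List I
  | 0 => []
  | k + 1 => i :: alt j i k

theorem comp_alt_refl {W I : Type*} {R : I → W → W → Prop} {i j : I}
    (hi : ∀ w, R i w w) (hj : ∀ w, R j w w) (k : ℕ) (w : W) : comp R (alt i j k) w w := by
  induction k generalizing i j with
  | zero => rfl
  | succ k ih => exact ⟨w, hi w, ih hj hi⟩

theorem reflTransGen_of_comp_alt {W I : Type*} {R : I → W → W → Prop} {i j : I} {k : ℕ} {w v : W}
    (h : comp R (alt i j k) w v) :
    Relation.ReflTransGen (fun a b => R i a b ∨ R j a b) w v := by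
  induction k generalizing i j w with
  | zero => exact h ▸ .refl
  | succ k ih =>
    obtain ⟨u, hu, h⟩ := h
    exact .head (.inl hu) (Relation.ReflTransGen.mono (fun _ _ => Or.symm) _ _ (ih h))

/-- A step along a transitive `R i` is absorbed by a composition that starts with `i`. -/
theorem comp_alt_absorb {W I : Type*} {R : I → W → W → Prop} {i j : I} {k : ℕ} (hk : 1 ≤ k)
    (hi : ∀ {a b c}, R i a b → R i b c → R i a c) {w u v : W}
    (hu : R i w u) (h : comp R (alt i j k) u v) : comp R (alt i j k) w v := by
  obtain ⟨k, rfl⟩ := Nat.exists_eq_add_of_le' hk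
  obtain ⟨x, hx, h⟩ := h
  exact ⟨x, hi hu hx, h⟩

/-- Semantic counterpart of the appendix theorem for C^b-S5₂: the common-knowledge
relation of `{i, j}` coincides with the composition along the alternating list of
length `2b`. -/
theorem reflTransGen_iff_alt {W I : Type*} (R : I → W → W → Prop) (i j : I) (hij : i ≠ j)
    (hEi : Equivalence (R i)) (hEj : Equivalence (R j))
    (b : ℕ) (hb : 1 ≤ b)
    (hC₁ : ∀ w v : W, comp R (alt j i (2 * b)) w v → comp R (alt i j (2 * b)) w v)
    (hC₂ : ∀ w v : W, comp R (alt i j (2 * b)) w v → comp R (alt j i (2 * b)) w v) :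
    ∀ w w' : W,
      Relation.ReflTransGen (fun a b' => R i a b' ∨ R j a b') w w' ↔
        comp R (alt i j (2 * b)) w w' := by
  refine fun w w' => ⟨fun h => ?_, reflTransGen_of_comp_alt⟩
  have hk : 1 ≤ 2 * b := by omega
  induction h using Relation.ReflTransGen.head_induction_on with
  | refl => exact comp_alt_refl hEi.refl hEj.refl _ _
  | head hu _ ih =>
    rcases hu with hu | hu
    · exact comp_alt_absorb hk hEi.trans hu ih
    · exact hC₁ _ _ (comp_alt_absorb hk hEj.trans hu (hC₂ _ _ ih))
end

section
/- Let ℓ > 1 and assume each R i is an equivalence relation and R satisfies the weak commutativity frame property of degree ℓ. Let L = [i_1, …, i_m] be a duplicate-free list of agents with m ≥ ℓ, and let l be any list of agents all of whose entries occur in L. Then comp(l) ⊆ comp(L). (Semantic counterpart of the appendix lemma for wC_ℓ-S5_n: □_{i_1}…□_{i_m}φ → □_{v_1}…□_{v_λ}φ is a theorem for every word v over G = {i_1,…,i_m}.) -/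
/-- The weak commutativity frame property of degree `ℓ`. -/
def WeakCommFrame {W I : Type*} (R : I → W → W → Prop) (ℓ : ℕ) : Prop :=
  ∀ L π : List I, L.Nodup → L.length = ℓ → π.Perm L →
    ∀ w v : W, comp R π w v → comp R L w v

theorem comp_append {W I : Type*} (R : I → W → W → Prop) (l₁ l₂ : List I) (w v : W) :
    comp R (l₁ ++ l₂) w v ↔ ∃ u, comp R l₁ w u ∧ comp R l₂ u v := by
  induction l₁ generalizing w with
  | nil => simp [comp]
  | cons i l ih =>
    simp only [List.cons_append, comp, ih]
    constructor
    · rintro ⟨x, hx, u, hu, hv⟩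
      exact ⟨u, ⟨x, hx, hu⟩, hv⟩
    · rintro ⟨u, ⟨x, hx, hu⟩, hv⟩
      exact ⟨x, hx, u, hu, hv⟩

theorem comp_self {W I : Type*} {R : I → W → W → Prop} (hR : ∀ i w, R i w w) (l : List I)
    (w : W) : comp R l w w := by
  induction l with
  | nil => rfl
  | cons i l ih => exact ⟨w, hR i w, ih⟩

theorem WeakCommFrame.succ {W I : Type*} {R : I → W → W → Prop} {ℓ : ℕ} (hℓ : 1 < ℓ)
    (hC : WeakCommFrame R ℓ) : WeakCommFrame R (ℓ + 1) := by
  classical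
  intro L π hnd hlen hperm w v h
  have hπ : π.Nodup := hperm.nodup_iff.2 hnd
  have hπl : π.length = ℓ + 1 := hperm.length_eq.trans hlen
  rcases L with _ | ⟨a, L⟩
  · simp at hlen
  rcases π with _ | ⟨b, π⟩
  · simp at hπl
  have hL : L.length = ℓ := by simpa using hlen
  by_cases hab : b = a
  · subst hab
    obtain ⟨u, hu, huv⟩ := h
    exact ⟨u, hu, hC L π hnd.of_cons hL hperm.cons_inv u v huv⟩
  have ha : a ∈ π := by
    have : a ∈ b :: π := hperm.mem_iff.2 (by simp)
    simpa [Ne.symm hab] using this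
  have hrest : π.Perm (a :: π.erase a) := List.perm_cons_erase ha
  generalize π.erase a = rest at hrest
  have hba : (b :: a :: rest).Nodup := (hrest.cons b).nodup_iff.1 hπ
  have hrl : rest.length + 1 = ℓ := by
    have := hrest.length_eq
    simp at this hπl
    omega
  have htail : (b :: rest).Perm L :=
    (((List.Perm.swap b a rest).trans (hrest.symm.cons b)).trans hperm).cons_inv
  have h₁ : comp R (b :: a :: rest) w v := by
    obtain ⟨u, hu, huv⟩ := h
    exact ⟨u, hu, hC _ π hba.of_cons (by simpa using hrl) hrest u v huv⟩
  have h₂ : comp R (a :: b :: rest) w v := by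
    rcases List.eq_nil_or_concat' rest with rfl | ⟨r, c, rfl⟩
    · simp at hrl
      omega
    · rw [show b :: a :: (r ++ [c]) = (b :: a :: r) ++ [c] from rfl, comp_append] at h₁
      obtain ⟨u, hu, huv⟩ := h₁
      rw [show a :: b :: (r ++ [c]) = (a :: b :: r) ++ [c] from rfl, comp_append]
      have hr : (b :: a :: r).Nodup :=
        List.Nodup.of_append_left (l₂ := [c]) (by simpa using hba)
      refine ⟨u, hC _ _ ((List.Perm.swap b a r).nodup_iff.2 hr) ?_ (List.Perm.swap a b r) w u hu,
        huv⟩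
      simpa using hrl
  obtain ⟨u, hu, huv⟩ := h₂
  exact ⟨u, hu, hC L _ hnd.of_cons hL htail u v huv⟩

theorem WeakCommFrame.mono {W I : Type*} {R : I → W → W → Prop} {ℓ m : ℕ} (hℓ : 1 < ℓ)
    (hC : WeakCommFrame R ℓ) (hm : ℓ ≤ m) : WeakCommFrame R m := by
  induction m, hm using Nat.le_induction with
  | base => exact hC
  | succ n hn ih => exact ih.succ (by omega)

theorem WeakCommFrame.comp_cons_of_mem {W I : Type*} {R : I → W → W → Prop} {ℓ : ℕ}
    (hC : WeakCommFrame R ℓ) (hR : ∀ i {u v w}, R i u v → R i v w → R i u w) {L : List I}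
    (hnd : L.Nodup) (hlen : L.length = ℓ) {i : I} (hi : i ∈ L) {w v : W}
    (h : comp R (i :: L) w v) : comp R L w v := by
  classical
  have hperm : L.Perm (i :: L.erase i) := List.perm_cons_erase hi
  obtain ⟨u, hwu, huv⟩ := h
  obtain ⟨x, hux, hxv⟩ :=
    hC _ L (hperm.nodup_iff.1 hnd) (hperm.length_eq.symm.trans hlen) hperm u v huv
  exact hC L _ hnd hlen hperm.symm w v ⟨x, hR i hwu hux, hxv⟩

/-- Semantic counterpart of the appendix lemma for wC_ℓ-S5ₙ: any composition along a
word over the agents of a duplicate-free list `L` (with `|L| ≥ ℓ`) is contained in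
the composition along `L`. -/
theorem comp_subset_comp_weak {W I : Type*} (R : I → W → W → Prop)
    (hEq : ∀ i, Equivalence (R i))
    (ℓ : ℕ) (hℓ : 1 < ℓ) (hC : WeakCommFrame R ℓ)
    (L : List I) (hnd : L.Nodup) (hm : ℓ ≤ L.length)
    (l : List I) (hl : ∀ i ∈ l, i ∈ L) :
    ∀ w v : W, comp R l w v → comp R L w v := by
  have hC' := hC.mono hℓ hm
  induction l with
  | nil =>
    rintro w v rfl
    exact comp_self (fun i => (hEq i).refl) L w
  | cons i l ih =>
    rintro w v ⟨u, hwu, huv⟩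
    refine hC'.comp_cons_of_mem (fun i => (hEq i).trans) hnd rfl (hl i (by simp)) ⟨u, hwu, ?_⟩
    exact ih (fun j hj => hl j (by simp [hj])) u v huv
end
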